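/- Assume Hypothesis (⋆) and let (x,y) be an arc of Δ. Then either the generalised Fitting subgroup F*(G_{x,y}) is a p-group for some prime p, or (after possibly interchanging x and y) G_{x,y}^{[1]} = G_x^{[2]} and G_y^{[2]} = 1. -/

import Mathlib

open Equiv Subgroup

/-- `N` (a subgroup of `Perm V`) acts transitively on the neighbourhood of `x`. -/
def transOn {V : Type*} (Δ : SimpleGraph V) (N : Subgroup (Equiv.Perm V)) (x : V) : Prop :=
  ∀ u ∈ Δ.neighborSet x, ∀ v ∈ Δ.neighborSet x, ∃ g ∈ N, g u = v

/-- The permutation group induced by `N` on the neighbourhood of `x` is semiregular. -/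
def semiregOn {V : Type*} (Δ : SimpleGraph V) (N : Subgroup (Equiv.Perm V)) (x : V) : Prop :=
  ∀ g ∈ N, (∃ u ∈ Δ.neighborSet x, g u = u) → ∀ v ∈ Δ.neighborSet x, g v = v

/-- The stabiliser `G_x`. -/
def vstab {V : Type*} (G : Subgroup (Equiv.Perm V)) (x : V) : Subgroup (Equiv.Perm V) :=
  G ⊓ MulAction.stabilizer (Equiv.Perm V) x

/-- `G_x^{[i]}`: pointwise stabiliser of the ball of radius `i` around `x`. -/
def ball {V : Type*} (Δ : SimpleGraph V) (G : Subgroup (Equiv.Perm V)) (x : V) (i : ℕ) :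
    Subgroup (Equiv.Perm V) :=
  G ⊓ ⨅ z ∈ {z : V | Δ.dist x z ≤ i}, MulAction.stabilizer (Equiv.Perm V) z

/-- `K` is a normal subgroup of `H` (both subgroups of `Perm V`). -/
def normalIn {V : Type*} (K H : Subgroup (Equiv.Perm V)) : Prop :=
  K ≤ H ∧ ∀ h ∈ H, ∀ k ∈ K, h * k * h⁻¹ ∈ K

/-- `O_p(H)`: the largest normal `p`-subgroup of `H`. -/
def Op {V : Type*} (p : ℕ) (H : Subgroup (Equiv.Perm V)) : Subgroup (Equiv.Perm V) :=
  sSup {K | normalIn K H ∧ IsPGroup p K}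

/-- `E_x = ⟨O_p(G_{x,z}) : z ∈ Δ(x)⟩`. -/
def Ep {V : Type*} (Δ : SimpleGraph V) (G : Subgroup (Equiv.Perm V)) (p : ℕ) (x : V) :
    Subgroup (Equiv.Perm V) :=
  ⨆ z ∈ Δ.neighborSet x, Op p (vstab G x ⊓ vstab G z)

/-- `C_{G_x}(G_x^{[1]})`. -/
def locCent {V : Type*} (Δ : SimpleGraph V) (G : Subgroup (Equiv.Perm V)) (x : V) :
    Subgroup (Equiv.Perm V) :=
  vstab G x ⊓ Subgroup.centralizer ((ball Δ G x 1 : Subgroup (Equiv.Perm V)) : Set (Equiv.Perm V))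

/-- Hypothesis (⋆). -/
def StarHyp {V : Type*} (Δ : SimpleGraph V) (G : Subgroup (Equiv.Perm V)) : Prop :=
  ∀ x : V,
    transOn Δ (vstab G x) x ∧
    (transOn Δ (locCent Δ G x) x ∨ semiregOn Δ (locCent Δ G x) x) ∧
    ∀ p : ℕ, p.Prime → (transOn Δ (Ep Δ G p x) x ∨ semiregOn Δ (Ep Δ G p x) x)

/-- `G` is a group of automorphisms of `Δ`. -/
def isAut {V : Type*} (Δ : SimpleGraph V) (G : Subgroup (Equiv.Perm V)) : Prop :=
  ∀ g ∈ G, ∀ u v : V, Δ.Adj (g u) (g v) ↔ Δ.Adj u v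

/-- `K` is a subnormal subgroup of `H`. -/
def subnormalIn {V : Type*} (K H : Subgroup (Equiv.Perm V)) : Prop :=
  ∃ (n : ℕ) (c : ℕ → Subgroup (Equiv.Perm V)),
    c 0 = K ∧ c n = H ∧ ∀ i < n, normalIn (c i) (c (i + 1))

/-- `K` is quasisimple: perfect and simple modulo its centre. -/
def IsQuasisimple {V : Type*} (K : Subgroup (Equiv.Perm V)) : Prop :=
  commutator ↥K = ⊤ ∧ IsSimpleGroup (↥K ⧸ Subgroup.center ↥K)

/-- `E(H)`: the layer, generated by the components of `H`. -/
def layer {V : Type*} (H : Subgroup (Equiv.Perm V)) : Subgroup (Equiv.Perm V) :=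
  sSup {K | subnormalIn K H ∧ IsQuasisimple K}

/-- `F(H)`: the Fitting subgroup of `H`. -/
def fitting {V : Type*} (H : Subgroup (Equiv.Perm V)) : Subgroup (Equiv.Perm V) :=
  sSup {K | normalIn K H ∧ Group.IsNilpotent ↥K}

/-- `F*(H) = E(H)F(H)`: the generalised Fitting subgroup of `H`. -/
def genFitting {V : Type*} (H : Subgroup (Equiv.Perm V)) : Subgroup (Equiv.Perm V) :=
  layer H ⊔ fitting H


/-- `A` normalises `N`. -/
def nrm {V : Type*} (A N : Subgroup (Equiv.Perm V)) : Prop :=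
  ∀ h ∈ A, ∀ k ∈ N, h * k * h⁻¹ ∈ N

theorem nrm_iff {V : Type*} {A N : Subgroup (Equiv.Perm V)} :
    nrm A N ↔ A ≤ Subgroup.normalizer (N : Set (Equiv.Perm V)) := by
  constructor
  · intro h a ha
    rw [Subgroup.mem_normalizer_iff]
    intro k
    refine ⟨h a ha k, fun hk => ?_⟩
    have := h a⁻¹ (A.inv_mem ha) _ hk
    simpa [mul_assoc] using this
  · intro h a ha k hk
    exact (Subgroup.mem_normalizer_iff.1 (h ha) k).1 hk

theorem nrm_sup {V : Type*} {A N M : Subgroup (Equiv.Perm V)} (h1 : nrm A N) (h2 : nrm A M) :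
    nrm A (N ⊔ M) := by
  intro a ha k hk
  have : N ⊔ M ≤ (N ⊔ M).comap (MulAut.conj a).toMonoidHom := by
    apply sup_le
    · intro n hn
      exact (le_sup_left : N ≤ N ⊔ M) (by simpa using h1 a ha n hn)
    · intro n hn
      exact (le_sup_right : M ≤ N ⊔ M) (by simpa using h2 a ha n hn)
  simpa using this hk

theorem exists_max_p {V : Type*} [Fintype V] (p : ℕ) (H : Subgroup (Equiv.Perm V)) :
    normalIn (Op p H) H ∧ IsPGroup p (Op p H) := by
  classical
  have hfin : (({K | normalIn K H ∧ IsPGroup p K}) : Set (Subgroup (Equiv.Perm V))).Finite :=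
    Set.toFinite _
  have hne : ({K | normalIn K H ∧ IsPGroup p K} : Set (Subgroup (Equiv.Perm V))).Nonempty := by
    refine ⟨⊥, ⟨bot_le, ?_⟩, IsPGroup.of_bot⟩
    intro h _ k hk
    rw [Subgroup.mem_bot] at *
    simp [hk]
  obtain ⟨K0, hK0, hmax⟩ := hfin.exists_maximal hne
  have : Op p H = K0 := by
    apply le_antisymm
    · apply sSup_le
      intro K hK
      have hs : (K ⊔ K0) ∈ {K | normalIn K H ∧ IsPGroup p K} := by
        refine ⟨⟨sup_le hK.1.1 hK0.1.1, nrm_sup hK.1.2 hK0.1.2⟩, ?_⟩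
        apply IsPGroup.to_sup_of_normal_right' hK.2 hK0.2
        exact hK.1.1.trans (nrm_iff.1 hK0.1.2)
      exact le_sup_left.trans (hmax hs le_sup_right)
    · exact le_sSup hK0
  rw [this]
  exact hK0

theorem le_Op {V : Type*} {p : ℕ} {K H : Subgroup (Equiv.Perm V)} (h : normalIn K H)
    (hp : IsPGroup p K) : K ≤ Op p H := le_sSup ⟨h, hp⟩

theorem Op_le {V : Type*} {p : ℕ} {H : Subgroup (Equiv.Perm V)} : Op p H ≤ H :=
  sSup_le fun _ hK => hK.1.1

/-- conjugate of a subgroup -/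
def cj {V : Type*} (a : Equiv.Perm V) (N : Subgroup (Equiv.Perm V)) : Subgroup (Equiv.Perm V) :=
  N.map (MulAut.conj a).toMonoidHom

theorem mem_cj {V : Type*} {a k : Equiv.Perm V} {N : Subgroup (Equiv.Perm V)} :
    k ∈ cj a N ↔ a⁻¹ * k * a ∈ N := by
  unfold cj
  rw [Subgroup.mem_map]
  constructor
  · rintro ⟨n, hn, rfl⟩
    simpa [mul_assoc] using hn
  · intro h
    exact ⟨_, h, by simp [mul_assoc]⟩

theorem normalIn_cj {V : Type*} {a : Equiv.Perm V} {K H : Subgroup (Equiv.Perm V)}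
    (h : normalIn K H) : normalIn (cj a K) (cj a H) := by
  constructor
  · exact Subgroup.map_mono h.1
  · intro g hg k hk
    rw [mem_cj] at *
    have := h.2 _ hg _ hk
    simpa [mul_assoc] using this

theorem cj_eq {V : Type*} {A N : Subgroup (Equiv.Perm V)} (h : nrm A N) {a : Equiv.Perm V}
    (ha : a ∈ A) : cj a N = N := by
  ext k
  rw [mem_cj]
  constructor
  · intro hk
    have := h a ha _ hk
    simpa [mul_assoc] using this
  · intro hk
    have := h a⁻¹ (A.inv_mem ha) _ hk
    simpa [mul_assoc] using this

/-- the isomorphism to the conjugate -/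
noncomputable def cjEquiv {V : Type*} (a : Equiv.Perm V) (N : Subgroup (Equiv.Perm V)) :
    N ≃* cj a N :=
  N.equivMapOfInjective (MulAut.conj a).toMonoidHom (MulAut.conj a).injective

theorem mem_sSup_cj {V : Type*} {a : Equiv.Perm V} {S : Set (Subgroup (Equiv.Perm V))}
    (hS : ∀ K ∈ S, cj a K ∈ S) {k : Equiv.Perm V} (hk : k ∈ sSup S) :
    a * k * a⁻¹ ∈ sSup S := by
  have : sSup S ≤ (sSup S).comap (MulAut.conj a).toMonoidHom := by
    apply sSup_le
    intro K hK n hn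
    have h1 : cj a K ≤ sSup S := le_sSup (hS K hK)
    rw [Subgroup.mem_comap]
    apply h1
    exact Subgroup.mem_map_of_mem _ hn
  simpa using this hk

theorem nrm_Op {V : Type*} {A N : Subgroup (Equiv.Perm V)} (p : ℕ) (h : nrm A N) :
    nrm A (Op p N) := by
  intro a ha k hk
  refine mem_sSup_cj ?_ hk
  rintro K ⟨h1, h2⟩
  refine ⟨?_, h2.map _⟩
  have := normalIn_cj (a := a) h1
  rwa [cj_eq h ha] at this

theorem Op_mono {V : Type*} [Fintype V] {N H : Subgroup (Equiv.Perm V)} (p : ℕ)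
    (h : normalIn N H) : Op p N ≤ Op p H :=
  le_Op ⟨Op_le.trans h.1, nrm_Op p h.2⟩ (exists_max_p p N).2

theorem Op_inf {V : Type*} [Fintype V] {N H : Subgroup (Equiv.Perm V)} (p : ℕ)
    (h : normalIn N H) : Op p H ⊓ N ≤ Op p N := by
  refine le_Op ⟨inf_le_right, ?_⟩ ((exists_max_p p H).2.to_le inf_le_left)
  intro a ha k hk
  exact ⟨(exists_max_p p H).1.2 a (h.1 ha) k hk.1,
    N.mul_mem (N.mul_mem ha hk.2) (N.inv_mem ha)⟩

theorem Op_comm {V : Type*} [Fintype V] {H : Subgroup (Equiv.Perm V)} {p q : ℕ} (hp : p.Prime)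
    (hq : q.Prime) (hpq : p ≠ q) {a b : Equiv.Perm V} (ha : a ∈ Op p H) (hb : b ∈ Op q H) :
    a * b * a⁻¹ = b := by
  have := Fact.mk hp
  have := Fact.mk hq
  have hd := IsPGroup.disjoint_of_ne p q hpq _ _ (exists_max_p p H).2 (exists_max_p q H).2
  have h1 : a * b * a⁻¹ * b⁻¹ ∈ Op q H :=
    Subgroup.mul_mem _ ((exists_max_p q H).1.2 a (Op_le ha) b hb) (Subgroup.inv_mem _ hb)
  have h2 : a * b * a⁻¹ * b⁻¹ ∈ Op p H := by
    have := Subgroup.mul_mem _ ha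
      ((exists_max_p p H).1.2 b (Op_le hb) a⁻¹ (Subgroup.inv_mem _ ha))
    simpa [mul_assoc] using this
  have := Subgroup.disjoint_def.1 hd h2 h1
  exact mul_inv_eq_one.1 this

theorem subnormalIn_cj {V : Type*} {a : Equiv.Perm V} {K H : Subgroup (Equiv.Perm V)}
    (h : subnormalIn K H) : subnormalIn (cj a K) (cj a H) := by
  obtain ⟨n, c, h0, hn, hc⟩ := h
  refine ⟨n, fun i => cj a (c i), by simp [h0], by simp [hn], fun i hi => normalIn_cj (hc i hi)⟩

theorem subnormalIn_trans {V : Type*} {K N H : Subgroup (Equiv.Perm V)}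
    (h : subnormalIn K N) (hN : normalIn N H) : subnormalIn K H := by
  obtain ⟨n, c, h0, hn, hc⟩ := h
  refine ⟨n + 1, fun i => if i ≤ n then c i else H, by simp [h0], by simp, fun i hi => ?_⟩
  rcases Nat.lt_or_ge i n with h1 | h1
  · have h2 : i + 1 ≤ n := h1
    simp only [h1.le, h2, if_true]
    exact hc i h1
  · have : i = n := by omega
    subst this
    simp [hn, hN]

theorem subnormalIn_of_normalIn {V : Type*} {K N H : Subgroup (Equiv.Perm V)}
    (h : normalIn K N) (hN : subnormalIn N H) : subnormalIn K H := by
  obtain ⟨n, c, h0, hn, hc⟩ := hN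
  refine ⟨n + 1, fun i => if i = 0 then K else c (i - 1), by simp, by simp [hn], fun i hi => ?_⟩
  rcases Nat.eq_zero_or_pos i with h1 | h1
  · subst h1; simpa [h0] using h
  · obtain ⟨j, rfl⟩ : ∃ j, i = j + 1 := ⟨i - 1, by omega⟩
    simpa using hc j (by omega)

theorem subnormalIn_refl {V : Type*} (H : Subgroup (Equiv.Perm V)) : subnormalIn H H :=
  ⟨0, fun _ => H, rfl, rfl, by simp⟩

theorem subnormalIn_inf {V : Type*} {K N H : Subgroup (Equiv.Perm V)}
    (h : subnormalIn K H) (hK : K ≤ N) (hN : N ≤ H) : subnormalIn K N := by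
  obtain ⟨n, c, h0, hn, hc⟩ := h
  refine ⟨n, fun i => c i ⊓ N, by simp [h0, hK], by simp [hn, hN], fun i hi => ?_⟩
  refine ⟨inf_le_inf_right _ (hc i hi).1, fun a ha k hk => ⟨(hc i hi).2 a ha.1 k hk.1, ?_⟩⟩
  exact N.mul_mem (N.mul_mem ha.2 hk.2) (N.inv_mem ha.2)

theorem subnormalIn_le {V : Type*} {K H : Subgroup (Equiv.Perm V)}
    (h : subnormalIn K H) : K ≤ H := by
  obtain ⟨n, c, h0, hn, hc⟩ := h
  have : ∀ i ≤ n, c 0 ≤ c i := by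
    intro i
    induction i with
    | zero => intro _; exact le_rfl
    | succ i ih => intro hi; exact (ih (by omega)).trans (hc i (by omega)).1
  have := this n le_rfl
  rwa [h0, hn] at this

theorem quasi_equiv {V : Type*} {K M : Subgroup (Equiv.Perm V)} (e : K ≃* M)
    (h : IsQuasisimple K) : IsQuasisimple M := by
  obtain ⟨h1, h2⟩ := h
  constructor
  · have : (commutator K).map e.toMonoidHom = commutator M := by
      rw [commutator_def, Subgroup.map_commutator, commutator_def]
      rw [Subgroup.map_top_of_surjective e.toMonoidHom e.surjective]
    rw [← this, h1]
    exact Subgroup.map_top_of_surjective e.toMonoidHom e.surjective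
  · have he : (Subgroup.center K).map e.toMonoidHom = Subgroup.center M := by
      ext m
      rw [Subgroup.mem_map]
      constructor
      · rintro ⟨k, hk, rfl⟩
        rw [Subgroup.mem_center_iff] at *
        intro g
        obtain ⟨g', rfl⟩ := e.surjective g
        simpa using congrArg e (hk g')
      · intro hm
        refine ⟨e.symm m, ?_, by simp⟩
        rw [Subgroup.mem_center_iff] at *
        intro g
        have := congrArg e.symm (hm (e g))
        simpa using this
    exact (QuotientGroup.congr _ _ e he).isSimpleGroup_congr.1 h2

theorem nrm_layer {V : Type*} {A N : Subgroup (Equiv.Perm V)} (h : nrm A N) :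
    nrm A (layer N) := by
  intro a ha k hk
  refine mem_sSup_cj ?_ hk
  rintro K ⟨h1, h2⟩
  refine ⟨?_, quasi_equiv (cjEquiv a K) h2⟩
  have := subnormalIn_cj (a := a) h1
  rwa [cj_eq h ha] at this

theorem layer_mono {V : Type*} {N H : Subgroup (Equiv.Perm V)} (h : normalIn N H) :
    layer N ≤ layer H :=
  sSup_le fun _ hK => le_sSup ⟨subnormalIn_trans hK.1 h, hK.2⟩

theorem qs_normal {X : Type*} [Group X] (h1 : commutator X = ⊤)
    (h2 : IsSimpleGroup (X ⧸ Subgroup.center X)) (M : Subgroup X) [hM : M.Normal] :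
    M = ⊤ ∨ M ≤ Subgroup.center X := by
  have hn : (M.map (QuotientGroup.mk' (Subgroup.center X))).Normal :=
    hM.map _ (QuotientGroup.mk'_surjective _)
  rcases IsSimpleGroup.eq_bot_or_eq_top_of_normal _ hn with h | h
  · right
    rwa [Subgroup.map_eq_bot_iff, QuotientGroup.ker_mk'] at h
  · left
    rw [eq_top_iff, ← h1, commutator_def, Subgroup.commutator_le]
    have key : ∀ g : X, ∃ m ∈ M, ∃ z ∈ Subgroup.center X, g = m * z := by
      intro g
      have : QuotientGroup.mk' (Subgroup.center X) g ∈
          M.map (QuotientGroup.mk' (Subgroup.center X)) := by rw [h]; trivial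
      obtain ⟨m, hm, hmg⟩ := this
      refine ⟨m, hm, m⁻¹ * g, ?_, by simp⟩
      exact QuotientGroup.eq.1 hmg
    intro a _ b _
    obtain ⟨m, hm, z, hz, rfl⟩ := key a
    obtain ⟨n, hn, w, hw, rfl⟩ := key b
    rw [Subgroup.mem_center_iff] at hz hw
    rw [commutatorElement_def]
    have : m * z * (n * w) * (m * z)⁻¹ * (n * w)⁻¹ = m * n * m⁻¹ * n⁻¹ := by
      have e1 : m * z * (n * w) = m * n * (z * w) := by
        rw [mul_assoc, ← mul_assoc z, ← hz n]; simp only [mul_assoc]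
      have e2 : (m * z)⁻¹ * (n * w)⁻¹ = (z * w)⁻¹ * (m⁻¹ * n⁻¹) := by
        have : (n * w) * (m * z) = (n * m) * (z * w) := by
          rw [mul_assoc, ← mul_assoc w, ← hw m, hw z]; simp only [mul_assoc]
        rw [← mul_inv_rev, this]; simp only [mul_inv_rev, mul_assoc]
      rw [mul_assoc, e2, e1]; group
    rw [this]
    exact M.mul_mem (M.mul_mem (M.mul_mem hm hn) (M.inv_mem hm)) (M.inv_mem hn)

theorem component_lemma {V : Type*} {K L N : Subgroup (Equiv.Perm V)} (hs : subnormalIn K L)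
    (hq : IsQuasisimple K) (hN : normalIn N L) :
    K ≤ N ∨ ∀ k ∈ K, ∀ n ∈ N, n * k = k * n := by
  have hKL := subnormalIn_le hs
  have hperf : ⁅K, K⁆ = K := by
    have := congrArg (Subgroup.map K.subtype) hq.1
    rw [commutator_def, Subgroup.map_commutator] at this
    rwa [← MonoidHom.range_eq_map, Subgroup.range_subtype] at this
  have hnor : (N.subgroupOf K).Normal := by
    constructor
    intro n hn g
    exact hN.2 g (hKL g.2) n hn
  rcases qs_normal hq.1 hq.2 (N.subgroupOf K) with h | h
  · left; exact Subgroup.subgroupOf_eq_top.1 h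
  right
  obtain ⟨n, c, h0, hn, hc⟩ := hs
  let A : ℕ → Subgroup (Equiv.Perm V) := fun i => Nat.rec N (fun _ B => ⁅B, K⁆) i
  have A0 : A 0 = N := rfl
  have As : ∀ i, A (i + 1) = ⁅A i, K⁆ := fun i => rfl
  have hAN : ∀ i, A i ≤ N := by
    intro i
    induction i with
    | zero => exact le_rfl
    | succ i ih =>
      rw [As, Subgroup.commutator_le]
      intro a ha k hk
      have := N.mul_mem (ih ha) (hN.2 k (hKL hk) a⁻¹ (N.inv_mem (ih ha)))
      rw [commutatorElement_def]
      simpa [mul_assoc] using this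
  have hKc : ∀ i ≤ n, K ≤ c i := by
    intro i
    induction i with
    | zero => intro _; exact h0.ge
    | succ i ih => intro hi; exact (ih (by omega)).trans (hc i (by omega)).1
  have hAc : ∀ i ≤ n, A i ≤ c (n - i) := by
    intro i
    induction i with
    | zero => intro _; rw [A0, Nat.sub_zero, hn]; exact hN.1
    | succ i ih =>
      intro hi
      rw [As, Subgroup.commutator_le]
      intro a ha k hk
      have e : n - i = n - (i + 1) + 1 := by omega
      have ha' := ih (by omega) ha
      rw [e] at ha'
      have hk' := hKc (n - (i + 1)) (by omega) hk
      rw [commutatorElement_def]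
      exact Subgroup.mul_mem _ ((hc (n - (i + 1)) (by omega)).2 a ha' k hk')
        (Subgroup.inv_mem _ hk')
  have hbot : A (n + 1) = ⊥ := by
    rw [As, Subgroup.commutator_eq_bot_iff_le_centralizer]
    intro a ha
    have haK : a ∈ K := by
      have := hAc n le_rfl ha
      rwa [Nat.sub_self, h0] at this
    have : (⟨a, haK⟩ : K) ∈ Subgroup.center K := h (hAN n ha)
    rw [Subgroup.mem_center_iff] at this
    rw [Subgroup.mem_centralizer_iff]
    intro k hk
    exact congrArg Subtype.val (this ⟨k, hk⟩)
  have hdown : ∀ i, A (i + 2) = ⊥ → A (i + 1) = ⊥ := by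
    intro i hi
    have h1 : ⁅⁅A i, K⁆, K⁆ = ⊥ := hi
    have h2 : ⁅⁅K, A i⁆, K⁆ = ⊥ := by rwa [Subgroup.commutator_comm K (A i)]
    have h3 := Subgroup.commutator_commutator_eq_bot_of_rotate h2 h1
    have h4 : ⁅⁅K, K⁆, A i⁆ = ⊥ := by
      exact h3
    rw [hperf, Subgroup.commutator_comm] at h4
    exact h4
  have hall : ∀ i, A (i + 1) = ⊥ → A 1 = ⊥ := by
    intro i
    induction i with
    | zero => exact id
    | succ i ih => exact fun h => ih (hdown i h)
  have h1 := hall n hbot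
  change ⁅N, K⁆ = ⊥ at h1
  rw [Subgroup.commutator_eq_bot_iff_le_centralizer] at h1
  intro k hk m hm
  exact (Subgroup.mem_centralizer_iff.1 (h1 hm) k hk).symm

theorem subnormal_p_le {V : Type*} [Fintype V] {S T : Subgroup (Equiv.Perm V)} {p : ℕ}
    (hs : subnormalIn S T) (hp : IsPGroup p S) : S ≤ Op p T := by
  obtain ⟨n, c, h0, hn, hc⟩ := hs
  have : ∀ i ≤ n, S ≤ Op p (c i) := by
    intro i
    induction i with
    | zero =>
      intro _
      rw [h0]
      exact le_Op ⟨le_rfl, fun a ha k hk => S.mul_mem (S.mul_mem ha hk) (S.inv_mem ha)⟩ hp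
    | succ i ih => intro hi; exact (ih (by omega)).trans (Op_mono p (hc i (by omega)))
  have := this n le_rfl
  rwa [hn] at this

theorem trivial_of {V : Type*} [Fintype V] {T : Subgroup (Equiv.Perm V)}
    (hl : layer T = ⊥) (hO : ∀ r : ℕ, r.Prime → Op r T = ⊥) : T = ⊥ := by
  classical
  by_contra hT
  have hfin : ({S | subnormalIn S T ∧ S ≠ ⊥} : Set (Subgroup (Equiv.Perm V))).Finite :=
    Set.toFinite _
  obtain ⟨S, ⟨hS, hSne⟩, hmin⟩ := hfin.exists_minimal ⟨T, subnormalIn_refl T, hT⟩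
  have : Nontrivial S := (Subgroup.nontrivial_iff_ne_bot S).2 hSne
  have hsimple : IsSimpleGroup S := by
    constructor
    intro M hM
    by_cases hb : M = ⊥
    · left; exact hb
    right
    have hin : normalIn (M.map S.subtype) S := by
      constructor
      · rintro _ ⟨m, _, rfl⟩; exact m.2
      · rintro a ha _ ⟨m, hm, rfl⟩
        exact ⟨_, hM.conj_mem m hm ⟨a, ha⟩, rfl⟩
    have hne : M.map S.subtype ≠ ⊥ := by
      rw [Ne, Subgroup.map_eq_bot_iff_of_injective _ S.subtype_injective]; exact hb
    have := hmin ⟨subnormalIn_of_normalIn hin hS, hne⟩ hin.1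
    rw [eq_top_iff]
    intro s _
    obtain ⟨m, hm, hms⟩ := this s.2
    have : m = s := Subtype.ext hms
    exact this ▸ hm
  rcases IsSimpleGroup.eq_bot_or_eq_top_of_normal (Subgroup.center S) inferInstance with h | h
  · have hq : IsQuasisimple S := by
      constructor
      · rcases IsSimpleGroup.eq_bot_or_eq_top_of_normal (commutator S) inferInstance with h' | h'
        · rw [commutator_eq_bot_iff_center_eq_top, h] at h'
          exact absurd h' bot_ne_top
        · exact h'
      · exact ((QuotientGroup.quotientMulEquivOfEq h).trans
          (QuotientGroup.quotientBot (G := S))).isSimpleGroup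
    have : S ≤ layer T := le_sSup ⟨hS, hq⟩
    rw [hl] at this
    exact hSne (le_bot_iff.1 this)
  · have hcomm : ∀ a b : S, a * b = b * a := by
      intro a b
      have : b ∈ Subgroup.center S := by rw [h]; trivial
      exact Subgroup.mem_center_iff.1 this a
    let : CommGroup S := { (inferInstance : Group S) with mul_comm := hcomm }
    have hp : (Nat.card S).Prime := IsSimpleGroup.prime_card
    have hpg : IsPGroup (Nat.card S) S := IsPGroup.of_card (n := 1) (by simp)
    have := subnormal_p_le hS hpg
    rw [hO _ hp] at this
    exact hSne (le_bot_iff.1 this)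

theorem fitting_p {V : Type*} [Fintype V] {L : Subgroup (Equiv.Perm V)} {p : ℕ}
    (hO : ∀ r : ℕ, r.Prime → r ≠ p → Op r L = ⊥) : fitting L ≤ Op p L := by
  classical
  apply sSup_le
  rintro N ⟨hN, hnil⟩
  have hsyl := ((Group.isNilpotent_of_finite_tfae (G := N)).out 0 3).1 hnil
  have hbot : ∀ r : ℕ, r.Prime → r ≠ p → ¬ r ∣ Nat.card N := by
    intro r hr hrp hdvd
    have := Fact.mk hr
    obtain ⟨P⟩ : Nonempty (Sylow r N) := inferInstance
    have hPn := hsyl r ⟨hr⟩ P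
    have hle : (P : Subgroup N).map N.subtype ≤ Op r L := by
      have : (P : Subgroup N).map N.subtype ≤ Op r N := by
        refine le_Op ⟨?_, ?_⟩ (P.2.map _)
        · rintro _ ⟨m, _, rfl⟩; exact m.2
        · rintro a ha _ ⟨m, hm, rfl⟩
          exact ⟨_, hPn.conj_mem m hm ⟨a, ha⟩, rfl⟩
      exact this.trans (Op_mono r hN)
    rw [hO r hr hrp, le_bot_iff,
      Subgroup.map_eq_bot_iff_of_injective _ N.subtype_injective] at hle
    exact P.ne_bot_of_dvd_card hdvd hle
  refine le_Op hN (IsPGroup.of_card (n := (Nat.card N).primeFactorsList.length) ?_)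
  apply Nat.eq_prime_pow_of_unique_prime_dvd Nat.card_pos.ne'
  intro d hd hdd
  by_contra hne
  exact hbot d hd hne hdd

theorem mem_ball1 {V : Type*} {Δ : SimpleGraph V} {G : Subgroup (Equiv.Perm V)}
    (hconn : Δ.Connected) {x : V} {g : Equiv.Perm V} :
    g ∈ ball Δ G x 1 ↔ g ∈ G ∧ g x = x ∧ ∀ z, Δ.Adj x z → g z = z := by
  unfold ball
  simp only [Subgroup.mem_inf, Subgroup.mem_iInf, Set.mem_setOf_eq, MulAction.mem_stabilizer_iff,
    Equiv.Perm.smul_def]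
  refine and_congr_right fun _ => ⟨fun h => ⟨h x (by simp), fun z hz => h z ?_⟩, ?_⟩
  · exact (SimpleGraph.dist_eq_one_iff_adj.2 hz).le
  · rintro ⟨h1, h2⟩ z hz
    rcases Nat.lt_or_ge (Δ.dist x z) 1 with h | h
    · have : x = z := (hconn.dist_eq_zero_iff).1 (by omega)
      rw [← this, h1]
    · exact h2 z (SimpleGraph.dist_eq_one_iff_adj.1 (by omega))

theorem mem_ball2 {V : Type*} {Δ : SimpleGraph V} {G : Subgroup (Equiv.Perm V)}
    (hconn : Δ.Connected) {x y : V} (hxy : Δ.Adj x y) {g : Equiv.Perm V} :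
    g ∈ ball Δ G x 2 ↔ ∀ z, Δ.Adj x z → g ∈ ball Δ G x 1 ⊓ ball Δ G z 1 := by
  constructor
  · intro hg z hz
    unfold ball at hg
    simp only [Subgroup.mem_inf, Subgroup.mem_iInf, Set.mem_setOf_eq,
      MulAction.mem_stabilizer_iff, Equiv.Perm.smul_def] at hg
    have hz1 : Δ.dist x z = 1 := SimpleGraph.dist_eq_one_iff_adj.2 hz
    rw [Subgroup.mem_inf, mem_ball1 hconn, mem_ball1 hconn]
    refine ⟨⟨hg.1, hg.2 x (by simp), fun w hw => hg.2 w ?_⟩,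
      ⟨hg.1, hg.2 z (by omega), fun w hw => hg.2 w ?_⟩⟩
    · have := SimpleGraph.dist_eq_one_iff_adj.2 hw; omega
    · have := SimpleGraph.dist_eq_one_iff_adj.2 hw
      have := hconn.dist_triangle (u := x) (v := z) (w := w)
      omega
  · intro hg
    have hG := ((mem_ball1 hconn).1 (hg y hxy).1).1
    unfold ball
    simp only [Subgroup.mem_inf, Subgroup.mem_iInf, Set.mem_setOf_eq,
      MulAction.mem_stabilizer_iff, Equiv.Perm.smul_def]
    refine ⟨hG, fun w hw => ?_⟩
    obtain ⟨p, hp⟩ := hconn.exists_walk_length_eq_dist x w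
    rw [← hp] at hw
    cases p with
    | nil => exact ((mem_ball1 hconn).1 (hg y hxy).1).2.1
    | cons h p =>
      cases p with
      | nil => exact ((mem_ball1 hconn).1 (hg y hxy).1).2.2 _ h
      | cons h' p =>
        cases p with
        | nil => exact ((mem_ball1 hconn).1 (hg _ h).2).2.2 _ h'
        | cons h'' p => simp at hw

theorem mem_vstab {V : Type*} {G : Subgroup (Equiv.Perm V)} {x : V} {g : Equiv.Perm V} :
    g ∈ vstab G x ↔ g ∈ G ∧ g x = x := by
  simp [vstab, Subgroup.mem_inf, MulAction.mem_stabilizer_iff]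

theorem conj_ball1 {V : Type*} {Δ : SimpleGraph V} {G : Subgroup (Equiv.Perm V)}
    (hconn : Δ.Connected) (hG : isAut Δ G) {x : V} {a g : Equiv.Perm V} (ha : a ∈ G)
    (hg : g ∈ ball Δ G x 1) : a * g * a⁻¹ ∈ ball Δ G (a x) 1 := by
  rw [mem_ball1 hconn] at *
  refine ⟨G.mul_mem (G.mul_mem ha hg.1) (G.inv_mem ha), by simp [hg.2.1], fun z hz => ?_⟩
  have h1 : Δ.Adj x (a⁻¹ z) := by
    rw [← hG a ha]; simpa using hz
  have := hg.2.2 _ h1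
  simp only [Equiv.Perm.mul_apply, this]
  simp

theorem nrm_ball1 {V : Type*} {Δ : SimpleGraph V} {G : Subgroup (Equiv.Perm V)}
    (hconn : Δ.Connected) (hG : isAut Δ G) (x : V) : nrm (vstab G x) (ball Δ G x 1) := by
  intro a ha k hk
  rw [mem_vstab] at ha
  have := conj_ball1 hconn hG ha.1 hk
  rwa [ha.2] at this

theorem nrm_ball2 {V : Type*} {Δ : SimpleGraph V} {G : Subgroup (Equiv.Perm V)}
    (hconn : Δ.Connected) (hG : isAut Δ G) {x y : V} (hxy : Δ.Adj x y) :
    nrm (vstab G x) (ball Δ G x 2) := by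
  intro a ha k hk
  rw [mem_ball2 hconn hxy] at *
  intro z hz
  have ha' := mem_vstab.1 ha
  have h1 : Δ.Adj x (a⁻¹ z) := by
    rw [← hG a ha'.1]; simpa [ha'.2] using hz
  refine ⟨nrm_ball1 hconn hG x a ha k (hk _ h1).1, ?_⟩
  have := conj_ball1 hconn hG ha'.1 (hk _ h1).2
  simpa using this

theorem ball1_le {V : Type*} {Δ : SimpleGraph V} {G : Subgroup (Equiv.Perm V)}
    (hconn : Δ.Connected) {x y : V} (hxy : Δ.Adj x y) :
    ball Δ G x 1 ≤ vstab G x ⊓ vstab G y := by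
  intro g hg
  rw [mem_ball1 hconn] at hg
  exact ⟨mem_vstab.2 ⟨hg.1, hg.2.1⟩, mem_vstab.2 ⟨hg.1, hg.2.2 y hxy⟩⟩

theorem ball1_normal {V : Type*} {Δ : SimpleGraph V} {G : Subgroup (Equiv.Perm V)}
    (hconn : Δ.Connected) (hG : isAut Δ G) {x y : V} (hxy : Δ.Adj x y) :
    normalIn (ball Δ G x 1) (vstab G x ⊓ vstab G y) :=
  ⟨ball1_le hconn hxy, fun a ha => nrm_ball1 hconn hG x a ha.1⟩

theorem ball2_le {V : Type*} {Δ : SimpleGraph V} {G : Subgroup (Equiv.Perm V)}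
    (hconn : Δ.Connected) {x y : V} (hxy : Δ.Adj x y) :
    ball Δ G x 2 ≤ ball Δ G x 1 ⊓ ball Δ G y 1 :=
  fun _ hg => (mem_ball2 hconn hxy).1 hg y hxy

/-- A subgroup of `G_{x,y}` normalised by locally transitive groups at `x`, `y` is trivial. -/
theorem eq_bot_of_nrm {V : Type*} {Δ : SimpleGraph V} {G : Subgroup (Equiv.Perm V)}
    (hconn : Δ.Connected) (hG : isAut Δ G) {x y : V} (hxy : Δ.Adj x y)
    {N A B : Subgroup (Equiv.Perm V)} (hN : N ≤ vstab G x ⊓ vstab G y)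
    (hA : A ≤ vstab G x) (hB : B ≤ vstab G y) (hAN : nrm A N) (hBN : nrm B N)
    (tA : transOn Δ A x) (tB : transOn Δ B y) : N = ⊥ := by
  have hH : nrm (A ⊔ B) N := nrm_iff.2 (sup_le (nrm_iff.1 hAN) (nrm_iff.1 hBN))
  have hHG : A ⊔ B ≤ G :=
    sup_le (hA.trans inf_le_left) (hB.trans inf_le_left)
  have key : ∀ {u v : V} (p : Δ.Walk u v), (∃ h ∈ A ⊔ B, u = h x ∨ u = h y) →
      ∃ h ∈ A ⊔ B, v = h x ∨ v = h y := by
    intro u v p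
    induction p with
    | nil => exact id
    | @cons u w v hadj p ih =>
      rintro ⟨h, hh, hu | hu⟩
      · apply ih
        have h1 : Δ.Adj x (h⁻¹ w) := by
          rw [← hG h (hHG hh)]; rw [hu] at hadj; simpa using hadj
        obtain ⟨a, ha, hay⟩ := tA y hxy _ h1
        refine ⟨h * a, Subgroup.mul_mem _ hh ((le_sup_left : A ≤ A ⊔ B) ha), Or.inr ?_⟩
        simp [hay]
      · apply ih
        have h1 : Δ.Adj y (h⁻¹ w) := by
          rw [← hG h (hHG hh)]; rw [hu] at hadj; simpa using hadj
        obtain ⟨a, ha, hay⟩ := tB x hxy.symm _ h1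
        refine ⟨h * a, Subgroup.mul_mem _ hh ((le_sup_right : B ≤ A ⊔ B) ha), Or.inl ?_⟩
        simp [hay]
  rw [Subgroup.eq_bot_iff_forall]
  intro n hn
  ext v
  obtain ⟨p⟩ := hconn.preconnected x v
  obtain ⟨h, hh, hv⟩ := key p ⟨1, Subgroup.one_mem _, Or.inl rfl⟩
  have h1 := hH h⁻¹ (Subgroup.inv_mem _ hh) n hn
  have h2 := hN h1
  have h3 : ∀ w, (h⁻¹ * n * h⁻¹⁻¹) w = w → n (h w) = h w := by
    intro w hw
    have := congrArg h hw
    simpa using this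
  rcases hv with rfl | rfl
  · simpa using h3 _ (mem_vstab.1 h2.1).2
  · simpa using h3 _ (mem_vstab.1 h2.2).2

theorem eq_ball2 {V : Type*} {Δ : SimpleGraph V} {G : Subgroup (Equiv.Perm V)}
    (hconn : Δ.Connected) (hG : isAut Δ G) {x y : V} (hxy : Δ.Adj x y)
    {A : Subgroup (Equiv.Perm V)} (hA : A ≤ vstab G x) (tA : transOn Δ A x)
    (hn : nrm A (ball Δ G x 1 ⊓ ball Δ G y 1)) :
    ball Δ G x 1 ⊓ ball Δ G y 1 = ball Δ G x 2 := by
  apply le_antisymm _ (ball2_le hconn hxy)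
  intro t ht
  rw [mem_ball2 hconn hxy]
  intro z hz
  refine ⟨ht.1, ?_⟩
  obtain ⟨a, ha, haz⟩ := tA y hxy z hz
  have h1 := hn a⁻¹ (A.inv_mem ha) t ht
  have h2 := conj_ball1 hconn hG (mem_vstab.1 (hA ha)).1 h1.2
  rw [haz] at h2
  simpa [mul_assoc] using h2

theorem Ep_le {V : Type*} {Δ : SimpleGraph V} {G : Subgroup (Equiv.Perm V)} {p : ℕ} {x : V} :
    Ep Δ G p x ≤ vstab G x :=
  iSup₂_le fun _ _ => Op_le.trans inf_le_left

theorem lemmaA {V : Type*} {Δ : SimpleGraph V} {G : Subgroup (Equiv.Perm V)}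
    (hconn : Δ.Connected) (hG : isAut Δ G) (hstar : StarHyp Δ G) {x y : V} (hxy : Δ.Adj x y)
    (ht : transOn Δ (locCent Δ G x) x) :
    ball Δ G x 1 ⊓ ball Δ G y 1 = ball Δ G x 2 ∧ ball Δ G y 2 = ⊥ := by
  have hn : ∀ N ≤ ball Δ G x 1, nrm (locCent Δ G x) N := by
    intro N hN a ha k hk
    have := Subgroup.mem_centralizer_iff.1 ha.2 k (hN hk)
    rw [← this]; simpa using hk
  refine ⟨eq_ball2 hconn hG hxy inf_le_left ht (hn _ inf_le_left), ?_⟩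
  have h2 := ball2_le (G := G) hconn hxy.symm
  exact eq_bot_of_nrm hconn hG hxy (h2.trans (inf_le_right.trans (ball1_le hconn hxy)))
    inf_le_left le_rfl (hn _ (h2.trans inf_le_right)) (nrm_ball2 hconn hG hxy.symm) ht (hstar y).1

theorem layer_le {V : Type*} {Δ : SimpleGraph V} {G : Subgroup (Equiv.Perm V)}
    (hconn : Δ.Connected) (hG : isAut Δ G) {x y : V} (hxy : Δ.Adj x y)
    (hs : semiregOn Δ (locCent Δ G x) x) :
    layer (vstab G x ⊓ vstab G y) = layer (ball Δ G x 1) := by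
  apply le_antisymm _ (layer_mono (ball1_normal hconn hG hxy))
  apply sSup_le
  rintro K ⟨hK, hq⟩
  have hKle : K ≤ ball Δ G x 1 := by
    rcases component_lemma hK hq (ball1_normal hconn hG hxy) with h | h
    · exact h
    · intro k hk
      have hkL := subnormalIn_le hK hk
      have h1 : k ∈ locCent Δ G x := ⟨hkL.1, Subgroup.mem_centralizer_iff.2 (h k hk)⟩
      rw [mem_ball1 hconn]
      exact ⟨(mem_vstab.1 hkL.1).1, (mem_vstab.1 hkL.1).2,
        hs k h1 ⟨y, hxy, (mem_vstab.1 hkL.2).2⟩⟩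
  exact le_sSup ⟨subnormalIn_inf hK hKle (ball1_le hconn hxy), hq⟩

theorem Op_le_ball {V : Type*} {Δ : SimpleGraph V} {G : Subgroup (Equiv.Perm V)}
    (hconn : Δ.Connected) {x y : V} (hxy : Δ.Adj x y) {p : ℕ}
    (hs : semiregOn Δ (Ep Δ G p x) x) :
    Op p (vstab G x ⊓ vstab G y) ≤ ball Δ G x 1 := by
  intro k hk
  have hkL := Op_le hk
  have h1 : k ∈ Ep Δ G p x := by
    have : Op p (vstab G x ⊓ vstab G y) ≤ Ep Δ G p x :=
      le_iSup₂_of_le (f := fun z (_ : z ∈ Δ.neighborSet x) => Op p (vstab G x ⊓ vstab G z))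
        y hxy le_rfl
    exact this hk
  rw [mem_ball1 hconn]
  exact ⟨(mem_vstab.1 hkL.1).1, (mem_vstab.1 hkL.1).2,
    hs k h1 ⟨y, hxy, (mem_vstab.1 hkL.2).2⟩⟩

theorem lemmaB {V : Type*} [Fintype V] {Δ : SimpleGraph V} {G : Subgroup (Equiv.Perm V)}
    (hconn : Δ.Connected) (hG : isAut Δ G) {x y : V} (hxy : Δ.Adj x y) {p : ℕ}
    (ht : transOn Δ (Ep Δ G p x) x) (hs : semiregOn Δ (Ep Δ G p y) y) :
    ball Δ G x 1 ⊓ ball Δ G y 1 = ball Δ G x 2 := by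
  refine eq_ball2 hconn hG hxy Ep_le ht ?_
  have hQ : Op p (ball Δ G x 1) ≤ ball Δ G x 1 ⊓ ball Δ G y 1 := by
    refine le_inf Op_le ?_
    refine (Op_mono p (ball1_normal hconn hG hxy)).trans ?_
    rw [inf_comm]
    exact Op_le_ball hconn hxy.symm hs
  rw [nrm_iff]
  refine iSup₂_le fun z hz => nrm_iff.1 ?_
  have hnz := ball1_normal hconn hG (x := x) (y := z) hz
  intro a ha t ht
  have h1 : a * t * a⁻¹ * t⁻¹ ∈ Op p (ball Δ G x 1) := by
    apply Op_inf p hnz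
    constructor
    · have := Subgroup.mul_mem _ ha ((exists_max_p p (vstab G x ⊓ vstab G z)).1.2 t
        (hnz.1 ht.1) a⁻¹ (Subgroup.inv_mem _ ha))
      simpa [mul_assoc] using this
    · exact Subgroup.mul_mem _ (hnz.2 a (Op_le ha) t ht.1) (Subgroup.inv_mem _ ht.1)
  have := Subgroup.mul_mem _ (hQ h1) ht
  simpa [mul_assoc] using this

/-- `E_s(x)` normalises every subgroup of `O_r(G_x^{[1]})` for `r ≠ s`. -/
theorem Ep_cent {V : Type*} [Fintype V] {Δ : SimpleGraph V} {G : Subgroup (Equiv.Perm V)}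
    (hconn : Δ.Connected) (hG : isAut Δ G) {x : V} {r s : ℕ} (hr : r.Prime)
    (hs : s.Prime) (hrs : s ≠ r) {N : Subgroup (Equiv.Perm V)} (hN : N ≤ Op r (ball Δ G x 1)) :
    nrm (Ep Δ G s x) N := by
  rw [nrm_iff]
  refine iSup₂_le fun z hz => nrm_iff.1 ?_
  intro a ha t ht
  rw [Op_comm hs hr hrs ha (Op_mono r (ball1_normal hconn hG hz) (hN ht))]
  exact ht

theorem lemmaC {V : Type*} [Fintype V] {Δ : SimpleGraph V} {G : Subgroup (Equiv.Perm V)}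
    (hconn : Δ.Connected) (hG : isAut Δ G) (hstar : StarHyp Δ G) {x y : V} (hxy : Δ.Adj x y)
    (hl : layer (vstab G x ⊓ vstab G y) = ⊥) {p q : ℕ} (hp : p.Prime) (hq : q.Prime)
    (hpq : p ≠ q) (tp : transOn Δ (Ep Δ G p x) x) (tq : transOn Δ (Ep Δ G q x) x) :
    ball Δ G y 2 = ⊥ := by
  have h2 : ball Δ G y 2 ≤ ball Δ G x 1 := (ball2_le hconn hxy.symm).trans inf_le_right
  have hnL : normalIn (ball Δ G y 2) (vstab G x ⊓ vstab G y) :=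
    ⟨h2.trans (ball1_le hconn hxy), fun a ha => nrm_ball2 hconn hG hxy.symm a ha.2⟩
  have hnQ : normalIn (ball Δ G y 2) (ball Δ G x 1) :=
    ⟨h2, fun a ha => hnL.2 a (ball1_le hconn hxy ha)⟩
  apply trivial_of
  · rw [← le_bot_iff, ← hl]; exact layer_mono hnL
  intro r hr
  obtain ⟨s, hs, hsr, ts⟩ : ∃ s : ℕ, s.Prime ∧ s ≠ r ∧ transOn Δ (Ep Δ G s x) x := by
    by_cases h : p = r
    · exact ⟨q, hq, fun h' => hpq (h.trans h'.symm), tq⟩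
    · exact ⟨p, hp, h, tp⟩
  exact eq_bot_of_nrm hconn hG hxy (Op_le.trans hnL.1) Ep_le le_rfl
    (Ep_cent hconn hG hr hs hsr (Op_mono r hnQ)) (nrm_Op r (nrm_ball2 hconn hG hxy.symm))
    ts (hstar y).1

theorem lemmaD {V : Type*} [Fintype V] {Δ : SimpleGraph V} {G : Subgroup (Equiv.Perm V)}
    (hconn : Δ.Connected) (hG : isAut Δ G) {x y : V} (hxy : Δ.Adj x y)
    (hl : layer (vstab G x ⊓ vstab G y) = ⊥) {p q : ℕ} (hp : p.Prime) (hq : q.Prime)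
    (hpq : p ≠ q) (tp : transOn Δ (Ep Δ G p x) x) (tq : transOn Δ (Ep Δ G q x) x)
    (tp' : transOn Δ (Ep Δ G p y) y) (tq' : transOn Δ (Ep Δ G q y) y) :
    ball Δ G x 1 ⊓ ball Δ G y 1 = ⊥ := by
  have hx := ball1_normal hconn hG hxy
  have hy := ball1_normal hconn hG hxy.symm
  rw [inf_comm] at hy
  have hnL : normalIn (ball Δ G x 1 ⊓ ball Δ G y 1) (vstab G x ⊓ vstab G y) :=
    ⟨inf_le_left.trans hx.1, fun a ha k hk => ⟨hx.2 a ha k hk.1, hy.2 a ha k hk.2⟩⟩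
  have hnx : normalIn (ball Δ G x 1 ⊓ ball Δ G y 1) (ball Δ G x 1) :=
    ⟨inf_le_left, fun a ha => hnL.2 a (hx.1 ha)⟩
  have hny : normalIn (ball Δ G x 1 ⊓ ball Δ G y 1) (ball Δ G y 1) :=
    ⟨inf_le_right, fun a ha => hnL.2 a (hy.1 ha)⟩
  apply trivial_of
  · rw [← le_bot_iff, ← hl]; exact layer_mono hnL
  intro r hr
  obtain ⟨s, hs, hsr, ts, ts'⟩ : ∃ s : ℕ, s.Prime ∧ s ≠ r ∧ transOn Δ (Ep Δ G s x) x ∧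
      transOn Δ (Ep Δ G s y) y := by
    by_cases h : p = r
    · exact ⟨q, hq, fun h' => hpq (h.trans h'.symm), tq, tq'⟩
    · exact ⟨p, hp, h, tp, tp'⟩
  exact eq_bot_of_nrm hconn hG hxy (Op_le.trans hnL.1) Ep_le Ep_le
    (Ep_cent hconn hG hr hs hsr (Op_mono r hnx)) (Ep_cent hconn hG hr hs hsr (Op_mono r hny))
    ts ts'

theorem Op_bot {V : Type*} [Fintype V] {Δ : SimpleGraph V} {G : Subgroup (Equiv.Perm V)}
    (hconn : Δ.Connected) (hG : isAut Δ G) (hstar : StarHyp Δ G) {x y : V} (hxy : Δ.Adj x y)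
    {p : ℕ} (sx : semiregOn Δ (Ep Δ G p x) x) (sy : semiregOn Δ (Ep Δ G p y) y) :
    Op p (vstab G x ⊓ vstab G y) = ⊥ := by
  have hx := ball1_normal hconn hG hxy
  have hy := ball1_normal hconn hG hxy.symm
  have h1 : Op p (vstab G x ⊓ vstab G y) = Op p (ball Δ G x 1) :=
    le_antisymm ((le_inf le_rfl (Op_le_ball hconn hxy sx)).trans (Op_inf p hx)) (Op_mono p hx)
  have h2 : Op p (vstab G y ⊓ vstab G x) = Op p (ball Δ G y 1) :=
    le_antisymm ((le_inf le_rfl (Op_le_ball hconn hxy.symm sy)).trans (Op_inf p hy))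
      (Op_mono p hy)
  rw [inf_comm] at h2
  refine eq_bot_of_nrm hconn hG hxy Op_le le_rfl le_rfl ?_ ?_ (hstar x).1 (hstar y).1
  · rw [h1]; exact nrm_Op p (nrm_ball1 hconn hG x)
  · rw [h2]; exact nrm_Op p (nrm_ball1 hconn hG y)

theorem layer_bot {V : Type*} {Δ : SimpleGraph V} {G : Subgroup (Equiv.Perm V)}
    (hconn : Δ.Connected) (hG : isAut Δ G) (hstar : StarHyp Δ G) {x y : V} (hxy : Δ.Adj x y)
    (sx : semiregOn Δ (locCent Δ G x) x) (sy : semiregOn Δ (locCent Δ G y) y) :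
    layer (vstab G x ⊓ vstab G y) = ⊥ := by
  have h1 := layer_le hconn hG hxy sx
  have h2 := layer_le hconn hG hxy.symm sy
  rw [inf_comm] at h2
  refine eq_bot_of_nrm hconn hG hxy (sSup_le fun K hK => subnormalIn_le hK.1) le_rfl le_rfl
    ?_ ?_ (hstar x).1 (hstar y).1
  · rw [h1]; exact nrm_layer (nrm_ball1 hconn hG x)
  · rw [h2]; exact nrm_layer (nrm_ball1 hconn hG y)

/-- Two distinct primes, `p` transitive at `x`. -/
theorem lemmaE {V : Type*} [Fintype V] {Δ : SimpleGraph V} {G : Subgroup (Equiv.Perm V)}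
    (hconn : Δ.Connected) (hG : isAut Δ G) (hstar : StarHyp Δ G) {x y : V} (hxy : Δ.Adj x y)
    (hl : layer (vstab G x ⊓ vstab G y) = ⊥) {p q : ℕ} (hp : p.Prime) (hq : q.Prime)
    (hpq : p ≠ q) (tp : transOn Δ (Ep Δ G p x) x)
    (hq2 : transOn Δ (Ep Δ G q x) x ∨ transOn Δ (Ep Δ G q y) y) :
    (ball Δ G x 1 ⊓ ball Δ G y 1 = ball Δ G x 2 ∧ ball Δ G y 2 = ⊥) ∨
    (ball Δ G x 1 ⊓ ball Δ G y 1 = ball Δ G y 2 ∧ ball Δ G x 2 = ⊥) := by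
  have hl' : layer (vstab G y ⊓ vstab G x) = ⊥ := by rwa [inf_comm]
  by_cases tq : transOn Δ (Ep Δ G q x) x
  · have hC := lemmaC hconn hG hstar hxy hl hp hq hpq tp tq
    by_cases tp' : transOn Δ (Ep Δ G p y) y
    · by_cases tq' : transOn Δ (Ep Δ G q y) y
      · have hD := lemmaD hconn hG hxy hl hp hq hpq tp tq tp' tq'
        have h1 := ball2_le (G := G) hconn hxy
        rw [hD, le_bot_iff] at h1
        left; exact ⟨by rw [hD, h1], hC⟩
      · left
        exact ⟨lemmaB hconn hG hxy tq (((hstar y).2.2 q hq).resolve_left tq'), hC⟩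
    · left
      exact ⟨lemmaB hconn hG hxy tp (((hstar y).2.2 p hp).resolve_left tp'), hC⟩
  · have tq' := hq2.resolve_left tq
    have hBy := lemmaB hconn hG hxy.symm tq' (((hstar x).2.2 q hq).resolve_left tq)
    rw [inf_comm] at hBy
    right
    refine ⟨hBy, ?_⟩
    by_cases tp' : transOn Δ (Ep Δ G p y) y
    · exact lemmaC hconn hG hstar hxy.symm hl' hp hq hpq tp' tq'
    · have hBx := lemmaB hconn hG hxy tp (((hstar y).2.2 p hp).resolve_left tp')
      refine eq_bot_of_nrm hconn hG hxy ?_ le_rfl le_rfl (nrm_ball2 hconn hG hxy) ?_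
        (hstar x).1 (hstar y).1
      · exact (ball2_le hconn hxy).trans (inf_le_left.trans (ball1_le hconn hxy))
      · rw [← hBx, hBy]; exact nrm_ball2 hconn hG hxy.symm

theorem stmt12 {V : Type*} [Fintype V] (Δ : SimpleGraph V) (G : Subgroup (Equiv.Perm V))
    (hconn : Δ.Connected) (hG : isAut Δ G) (hstar : StarHyp Δ G)
    {x y : V} (hxy : Δ.Adj x y) :
    (∃ p : ℕ, p.Prime ∧ IsPGroup p ↥(genFitting (vstab G x ⊓ vstab G y))) ∨
    (ball Δ G x 1 ⊓ ball Δ G y 1 = ball Δ G x 2 ∧ ball Δ G y 2 = ⊥) ∨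
    (ball Δ G x 1 ⊓ ball Δ G y 1 = ball Δ G y 2 ∧ ball Δ G x 2 = ⊥) := by

  by_cases cx : transOn Δ (locCent Δ G x) x
  · exact Or.inr (Or.inl (lemmaA hconn hG hstar hxy cx))
  by_cases cy : transOn Δ (locCent Δ G y) y
  · have := lemmaA hconn hG hstar hxy.symm cy
    rw [inf_comm] at this
    exact Or.inr (Or.inr this)
  have hl := layer_bot hconn hG hstar hxy ((hstar x).2.1.resolve_left cx)
    ((hstar y).2.1.resolve_left cy)
  by_cases hpr : ∃ p : ℕ, p.Prime ∧
      ∀ r : ℕ, r.Prime → r ≠ p → Op r (vstab G x ⊓ vstab G y) = ⊥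
  · left
    obtain ⟨p, hp, hO⟩ := hpr
    refine ⟨p, hp, ?_⟩
    unfold genFitting
    rw [hl, bot_sup_eq]
    exact (exists_max_p p _).2.to_le (fitting_p hO)
  right
  have htr : ∀ r : ℕ, r.Prime → Op r (vstab G x ⊓ vstab G y) ≠ ⊥ →
      transOn Δ (Ep Δ G r x) x ∨ transOn Δ (Ep Δ G r y) y := by
    intro r hr hne
    by_contra hcon
    rw [not_or] at hcon
    exact hne (Op_bot hconn hG hstar hxy (((hstar x).2.2 r hr).resolve_left hcon.1)
      (((hstar y).2.2 r hr).resolve_left hcon.2))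
  push Not at hpr
  obtain ⟨p, hp, -, hpne⟩ := hpr 2 Nat.prime_two
  obtain ⟨q, hq, hqp, hqne⟩ := hpr p hp
  rcases htr p hp hpne with tp | tp
  · exact lemmaE hconn hG hstar hxy hl hp hq hqp.symm tp (htr q hq hqne)
  · have := lemmaE hconn hG hstar hxy.symm (by rwa [inf_comm]) hp hq hqp.symm tp
      (htr q hq hqne).symm
    rw [inf_comm] at this
    exact this.symm
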